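/- Let m = 3k with k ≥ 1. Then every perfect matching of CGG(6k) all of whose edges have odd order and which contains all the boundary edges {3j+1, 3j+2} for j = 0, 1, …, 2k−1 is semi-simple, and the number of such perfect matchings is exactly k!. -/

import Mathlib

/-- The vertex set of the complete convex geometric graph `CGG(2m)`:
the vertices are labelled cyclically by `0, 1, …, 2m-1`. -/
abbrev Vtx (m : ℕ) := ZMod (2 * m)

/-- The order of an edge `{i,j}` of `CGG(2m)`: `min (|i-j|, 2m - |i-j|)`. -/
def edgeOrder (m : ℕ) : Sym2 (Vtx m) → ℕ :=
  Sym2.lift ⟨fun i j => min (i - j).val (j - i).val, fun i j => min_comm _ _⟩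

/-- The direction of an edge `{i,j}` of `CGG(2m)`: `i + j (mod 2m)`. -/
def edgeDir (m : ℕ) : Sym2 (Vtx m) → Vtx m :=
  Sym2.lift ⟨fun i j => i + j, fun i j => add_comm i j⟩

/-- `x` lies on the open cyclic arc from `a` to `b`, taken counterclockwise. -/
def InArc (m : ℕ) (a b x : Vtx m) : Prop :=
  0 < (x - a).val ∧ (x - a).val < (b - a).val

/-- Two edges of `CGG(2m)` cross: their endpoints interleave in the cyclic order,
i.e. writing them as `{a,b}` and `{c,d}`, exactly one of `c, d` lies on the open
cyclic arc from `a` to `b` taken counterclockwise. -/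
def Crosses (m : ℕ) (e f : Sym2 (Vtx m)) : Prop :=
  ∃ a b c d : Vtx m, e = s(a, b) ∧ f = s(c, d) ∧
    Xor' (InArc m a b c) (InArc m a b d)

/-- Two edges of `CGG(2m)` are neighbors: some endpoint of one differs by `±1`
(mod `2m`) from some endpoint of the other. -/
def Neighbors (m : ℕ) (e f : Sym2 (Vtx m)) : Prop :=
  ∃ x ∈ e, ∃ y ∈ f, x = y + 1 ∨ y = x + 1

/-- `M` is a perfect matching of `CGG(2m)`: a set of pairwise vertex-disjoint
edges covering all `2m` vertices. -/
def IsPM (m : ℕ) (M : Finset (Sym2 (Vtx m))) : Prop :=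
  (∀ e ∈ M, ¬ e.IsDiag) ∧
  (∀ e ∈ M, ∀ f ∈ M, e ≠ f → ∀ x : Vtx m, x ∈ e → x ∉ f) ∧
  (∀ x : Vtx m, ∃ e ∈ M, x ∈ e)

/-- `M` is a simple perfect matching (SPM) of `CGG(2m)`: a perfect matching
no two of whose edges cross. -/
def IsSPM (m : ℕ) (M : Finset (Sym2 (Vtx m))) : Prop :=
  IsPM m M ∧ ∀ e ∈ M, ∀ f ∈ M, e ≠ f → ¬ Crosses m e f

/-- `M` is a semi-simple perfect matching of `CGG(2m)`: a perfect matching all of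
whose edges have odd order, and no two neighboring edges of which cross. -/
def IsSemiSimple (m : ℕ) (M : Finset (Sym2 (Vtx m))) : Prop :=
  IsPM m M ∧ (∀ e ∈ M, Odd (edgeOrder m e)) ∧
  ∀ e ∈ M, ∀ f ∈ M, e ≠ f → Neighbors m e f → ¬ Crosses m e f

/-- `B` is a set of edges of `CGG(2m)` that meets every member of the family `F`,
of minimum cardinality among all sets of edges meeting every member of `F`. -/
def MinTransversal (m : ℕ) (F : Set (Finset (Sym2 (Vtx m))))
    (B : Finset (Sym2 (Vtx m))) : Prop :=
  (∀ e ∈ B, ¬ e.IsDiag) ∧ (∀ M ∈ F, (B ∩ M).Nonempty) ∧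
  ∀ B' : Finset (Sym2 (Vtx m)), (∀ e ∈ B', ¬ e.IsDiag) →
    (∀ M ∈ F, (B' ∩ M).Nonempty) → B.card ≤ B'.card

/-- `B` is a blocker of `CGG(2m)`: a set of edges meeting every SPM, of minimum
cardinality among all sets of edges meeting every SPM. -/
def IsBlocker (m : ℕ) (B : Finset (Sym2 (Vtx m))) : Prop :=
  MinTransversal m {M | IsSPM m M} B

/-- `C` is a co-blocker of `CGG(2m)`: a set of edges meeting every blocker, of
minimum cardinality among all sets of edges meeting every blocker. -/
def IsCoBlocker (m : ℕ) (C : Finset (Sym2 (Vtx m))) : Prop :=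
  MinTransversal m {B | IsBlocker m B} C

section SpecialMatchings

variable {k : ℕ}

/-- The boundary edge `{3j+1, 3j+2}` of `CGG(6k)`. -/
def boundaryEdge (k j : ℕ) : Sym2 (Vtx (3 * k)) :=
  s(((3 * j + 1 : ℕ) : Vtx (3 * k)), ((3 * j + 2 : ℕ) : Vtx (3 * k)))

/-- The edge `{6i, 6j+3}` of `CGG(6k)`. -/
def longEdge (k i j : ℕ) : Sym2 (Vtx (3 * k)) :=
  s(((6 * i : ℕ) : Vtx (3 * k)), ((6 * j + 3 : ℕ) : Vtx (3 * k)))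

lemma Vtx.natCast_inj {a b : ℕ} (ha : a < 6 * k) (hb : b < 6 * k) :
    ((a : ℕ) : Vtx (3 * k)) = ((b : ℕ) : Vtx (3 * k)) ↔ a = b := by
  rw [ZMod.natCast_eq_natCast_iff', Nat.mod_eq_of_lt (by omega), Nat.mod_eq_of_lt (by omega)]

lemma Vtx.exists_natCast (hk : 1 ≤ k) (x : Vtx (3 * k)) :
    ∃ a < 6 * k, x = ((a : ℕ) : Vtx (3 * k)) := by
  have : NeZero (2 * (3 * k)) := ⟨by omega⟩
  have := ZMod.val_lt x
  exact ⟨x.val, by omega, (ZMod.natCast_zmod_val x).symm⟩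

lemma Vtx.val_natCast_sub {a b : ℕ} (ha : a < 6 * k) (hb : b < 6 * k) :
    (((b : ℕ) : Vtx (3 * k)) - ((a : ℕ) : Vtx (3 * k))).val =
      if a ≤ b then b - a else 6 * k + b - a := by
  split_ifs with h
  · rw [← Nat.cast_sub h, ZMod.val_natCast, Nat.mod_eq_of_lt (by omega)]
  · have h1 : ((b : ℕ) : Vtx (3 * k)) - ((a : ℕ) : Vtx (3 * k)) =
        ((6 * k + b - a : ℕ) : Vtx (3 * k)) := by
      have h2 : ((6 * k : ℕ) : Vtx (3 * k)) = 0 :=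
        (ZMod.natCast_eq_zero_iff _ _).2 ⟨1, by ring⟩
      rw [Nat.cast_sub (by omega), Nat.cast_add, h2, zero_add]
    rw [h1, ZMod.val_natCast, Nat.mod_eq_of_lt (by omega)]

lemma odd_edgeOrder_natCast {a b : ℕ} (ha : a < 6 * k) (hb : b < 6 * k) :
    Odd (edgeOrder (3 * k) s(((a : ℕ) : Vtx (3 * k)), ((b : ℕ) : Vtx (3 * k)))) ↔
      Odd (a + b) := by
  have h : edgeOrder (3 * k) s(((a : ℕ) : Vtx (3 * k)), ((b : ℕ) : Vtx (3 * k))) =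
      min (((a : ℕ) : Vtx (3 * k)) - ((b : ℕ) : Vtx (3 * k))).val
        (((b : ℕ) : Vtx (3 * k)) - ((a : ℕ) : Vtx (3 * k))).val := rfl
  rw [h, Vtx.val_natCast_sub ha hb, Vtx.val_natCast_sub hb ha, Nat.odd_iff, Nat.odd_iff]
  split_ifs <;> omega

lemma not_crosses_of_boundaryEdge_left {j : ℕ} (hk : 1 ≤ k) (hj : j < 2 * k)
    {f : Sym2 (Vtx (3 * k))} (h : ∀ x ∈ boundaryEdge k j, x ∉ f) :
    ¬ Crosses (3 * k) (boundaryEdge k j) f := by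
  rintro ⟨a, b, c, d, he, rfl, hx⟩
  obtain ⟨c, hc, rfl⟩ := Vtx.exists_natCast hk c
  obtain ⟨d, hd, rfl⟩ := Vtx.exists_natCast hk d
  have h1 := h _ (Sym2.mem_mk_left _ _)
  have h2 := h _ (Sym2.mem_mk_right _ _)
  rw [Sym2.mem_iff, Vtx.natCast_inj (by omega) (by omega),
    Vtx.natCast_inj (by omega) (by omega)] at h1 h2
  rw [boundaryEdge, Sym2.eq_iff] at he
  rcases he with ⟨rfl, rfl⟩ | ⟨rfl, rfl⟩ <;>
  · rcases hx with hx | hx <;>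
    · simp (disch := omega) only [InArc, Vtx.val_natCast_sub] at hx
      split_ifs at hx <;> omega

lemma not_crosses_of_boundaryEdge_right {j : ℕ} (hk : 1 ≤ k) (hj : j < 2 * k)
    {e : Sym2 (Vtx (3 * k))} (h : ∀ x ∈ boundaryEdge k j, x ∉ e) :
    ¬ Crosses (3 * k) e (boundaryEdge k j) := by
  rintro ⟨a, b, c, d, rfl, he, hx⟩
  obtain ⟨a, ha, rfl⟩ := Vtx.exists_natCast hk a
  obtain ⟨b, hb, rfl⟩ := Vtx.exists_natCast hk b
  have h1 := h _ (Sym2.mem_mk_left _ _)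
  have h2 := h _ (Sym2.mem_mk_right _ _)
  rw [Sym2.mem_iff, Vtx.natCast_inj (by omega) (by omega),
    Vtx.natCast_inj (by omega) (by omega)] at h1 h2
  rw [boundaryEdge, Sym2.eq_iff] at he
  rcases he with ⟨rfl, rfl⟩ | ⟨rfl, rfl⟩ <;>
  · rcases hx with hx | hx <;>
    · simp (disch := omega) only [InArc, Vtx.val_natCast_sub] at hx
      split_ifs at hx <;> omega

lemma IsPM.eq_of_mem {m : ℕ} {M : Finset (Sym2 (Vtx m))} (hM : IsPM m M)
    {e f : Sym2 (Vtx m)} (he : e ∈ M) (hf : f ∈ M) {x : Vtx m} (hxe : x ∈ e) (hxf : x ∈ f) :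
    e = f := by
  by_contra h
  exact hM.2.1 e he f hf h x hxe hxf

lemma IsPM.eq_of_subset {m : ℕ} {M N : Finset (Sym2 (Vtx m))} (hM : IsPM m M)
    (hN : IsPM m N) (h : N ⊆ M) : N = M := by
  refine h.antisymm fun e he => ?_
  obtain ⟨f, hf, hx⟩ := hN.2.2 e.out.1
  rwa [hM.eq_of_mem he (h hf) (Sym2.out_fst_mem e) hx]

/-- In a perfect matching containing all the edges `{3j+1, 3j+2}`, every other edge joins
multiples of `3`. -/
lemma IsPM.eq_boundaryEdge_or_forall_mem (hk : 1 ≤ k) {M : Finset (Sym2 (Vtx (3 * k)))}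
    (hM : IsPM (3 * k) M) (hB : ∀ j < 2 * k, boundaryEdge k j ∈ M)
    {e : Sym2 (Vtx (3 * k))} (he : e ∈ M) :
    (∃ j < 2 * k, e = boundaryEdge k j) ∨
      ∀ x ∈ e, ∃ a < 2 * k, x = ((3 * a : ℕ) : Vtx (3 * k)) := by
  refine or_iff_not_imp_left.2 fun hne x hx => ?_
  obtain ⟨a, ha, rfl⟩ := Vtx.exists_natCast hk x
  refine ⟨a / 3, by omega, ?_⟩
  by_contra h
  have h0 : a ≠ 3 * (a / 3) := fun h' => h (congrArg _ h')
  refine hne ⟨a / 3, by omega, hM.eq_of_mem he (hB _ (by omega)) hx ?_⟩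
  rw [boundaryEdge, Sym2.mem_iff, Vtx.natCast_inj (by omega) (by omega),
    Vtx.natCast_inj (by omega) (by omega)]
  omega

lemma IsPM.isSemiSimple_of_boundaryEdge_mem (hk : 1 ≤ k) {M : Finset (Sym2 (Vtx (3 * k)))}
    (hM : IsPM (3 * k) M) (hodd : ∀ e ∈ M, Odd (edgeOrder (3 * k) e))
    (hB : ∀ j < 2 * k, boundaryEdge k j ∈ M) : IsSemiSimple (3 * k) M := by
  refine ⟨hM, hodd, fun e he f hf hef hn => ?_⟩
  rcases hM.eq_boundaryEdge_or_forall_mem hk hB he with ⟨j, hj, rfl⟩ | h1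
  · exact not_crosses_of_boundaryEdge_left hk hj (hM.2.1 _ he _ hf hef)
  rcases hM.eq_boundaryEdge_or_forall_mem hk hB hf with ⟨j, hj, rfl⟩ | h2
  · exact not_crosses_of_boundaryEdge_right hk hj (hM.2.1 _ hf _ he hef.symm)
  obtain ⟨x, hx, y, hy, hxy⟩ := hn
  obtain ⟨a, ha, rfl⟩ := h1 x hx
  obtain ⟨b, hb, rfl⟩ := h2 y hy
  rw [← Nat.cast_add_one, ← Nat.cast_add_one, Vtx.natCast_inj (by omega) (by omega),
    Vtx.natCast_inj (by omega) (by omega)] at hxy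
  omega

/-- The matching formed by the edges `{3j+1, 3j+2}` and the edges `{6i, 6σ(i)+3}`. -/
def permMatching (k : ℕ) (σ : Equiv.Perm (Fin k)) : Finset (Sym2 (Vtx (3 * k))) :=
  (Finset.range (2 * k)).image (boundaryEdge k) ∪
    Finset.univ.image fun i : Fin k => longEdge k i (σ i)

lemma mem_permMatching {σ : Equiv.Perm (Fin k)} {e : Sym2 (Vtx (3 * k))} :
    e ∈ permMatching k σ ↔
      (∃ j < 2 * k, e = boundaryEdge k j) ∨ ∃ i : Fin k, e = longEdge k i (σ i) := by
  simp [permMatching, eq_comm]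

lemma boundaryEdge_mem_permMatching (σ : Equiv.Perm (Fin k)) {j : ℕ} (hj : j < 2 * k) :
    boundaryEdge k j ∈ permMatching k σ :=
  mem_permMatching.2 (Or.inl ⟨j, hj, rfl⟩)

lemma longEdge_mem_permMatching (σ : Equiv.Perm (Fin k)) (i : Fin k) :
    longEdge k i (σ i) ∈ permMatching k σ :=
  mem_permMatching.2 (Or.inr ⟨i, rfl⟩)

lemma natCast_mem_boundaryEdge {a j : ℕ} (ha : a < 6 * k) (hj : j < 2 * k) :
    ((a : ℕ) : Vtx (3 * k)) ∈ boundaryEdge k j ↔ a = 3 * j + 1 ∨ a = 3 * j + 2 := by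
  rw [boundaryEdge, Sym2.mem_iff, Vtx.natCast_inj ha (by omega), Vtx.natCast_inj ha (by omega)]

lemma natCast_mem_longEdge {a i j : ℕ} (ha : a < 6 * k) (hi : i < k) (hj : j < k) :
    ((a : ℕ) : Vtx (3 * k)) ∈ longEdge k i j ↔ a = 6 * i ∨ a = 6 * j + 3 := by
  rw [longEdge, Sym2.mem_iff, Vtx.natCast_inj ha (by omega), Vtx.natCast_inj ha (by omega)]

lemma odd_edgeOrder_of_mem_permMatching (σ : Equiv.Perm (Fin k)) {e : Sym2 (Vtx (3 * k))}
    (he : e ∈ permMatching k σ) : Odd (edgeOrder (3 * k) e) := by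
  rcases mem_permMatching.1 he with ⟨j, hj, rfl⟩ | ⟨i, rfl⟩
  · rw [boundaryEdge, odd_edgeOrder_natCast (by omega) (by omega), Nat.odd_iff]
    omega
  · rw [longEdge, odd_edgeOrder_natCast (by omega) (by omega), Nat.odd_iff]
    omega

lemma isPM_permMatching (hk : 1 ≤ k) (σ : Equiv.Perm (Fin k)) :
    IsPM (3 * k) (permMatching k σ) := by
  refine ⟨fun e he => ?_, fun e he f hf hef x hxe hxf => hef ?_, fun x => ?_⟩
  · rcases mem_permMatching.1 he with ⟨j, hj, rfl⟩ | ⟨i, rfl⟩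
    · rw [boundaryEdge, Sym2.mk_isDiag_iff, Vtx.natCast_inj (by omega) (by omega)]
      omega
    · rw [longEdge, Sym2.mk_isDiag_iff, Vtx.natCast_inj (by omega) (by omega)]
      omega
  · obtain ⟨a, ha, rfl⟩ := Vtx.exists_natCast hk x
    rcases mem_permMatching.1 he with ⟨j, hj, rfl⟩ | ⟨i, rfl⟩ <;>
    rcases mem_permMatching.1 hf with ⟨j', hj', rfl⟩ | ⟨i', rfl⟩ <;>
    simp (disch := omega) only [natCast_mem_boundaryEdge, natCast_mem_longEdge] at hxe hxf
    · rw [show j = j' by omega]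
    · omega
    · omega
    · have h : i = i' ∨ σ i = σ i' := by
        rw [Fin.ext_iff, Fin.ext_iff]
        omega
      rw [h.elim id fun h => σ.injective h]
  · obtain ⟨a, ha, rfl⟩ := Vtx.exists_natCast hk x
    by_cases h3 : a % 3 = 0
    · by_cases h6 : a % 6 = 0
      · refine ⟨_, longEdge_mem_permMatching σ ⟨a / 6, by omega⟩, ?_⟩
        rw [natCast_mem_longEdge ha (Fin.is_lt _) (Fin.is_lt _)]
        left
        change a = 6 * (a / 6)
        omega
      · refine ⟨_, longEdge_mem_permMatching σ (σ.symm ⟨a / 6, by omega⟩), ?_⟩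
        rw [natCast_mem_longEdge ha (Fin.is_lt _) (Fin.is_lt _), σ.apply_symm_apply]
        right
        change a = 6 * (a / 6) + 3
        omega
    · refine ⟨_, boundaryEdge_mem_permMatching σ (j := a / 3) (by omega), ?_⟩
      rw [natCast_mem_boundaryEdge ha (by omega)]
      omega

lemma longEdge_right_injective {i j j' : ℕ} (hi : i < k) (hj : j < k) (hj' : j' < k)
    (h : longEdge k i j = longEdge k i j') : j = j' := by
  have : ((6 * j + 3 : ℕ) : Vtx (3 * k)) ∈ longEdge k i j' := h ▸ Sym2.mem_mk_right _ _
  rw [natCast_mem_longEdge (by omega) hi hj'] at this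
  omega

lemma longEdge_left_injective {i i' j : ℕ} (hi : i < k) (hi' : i' < k) (hj : j < k)
    (h : longEdge k i j = longEdge k i' j) : i = i' := by
  have : ((6 * i : ℕ) : Vtx (3 * k)) ∈ longEdge k i' j := h ▸ Sym2.mem_mk_left _ _
  rw [natCast_mem_longEdge (by omega) hi' hj] at this
  omega

lemma permMatching_injective (hk : 1 ≤ k) : Function.Injective (permMatching k) := by
  refine fun σ τ h => Equiv.ext fun i => Fin.ext ?_
  have hi : longEdge k i (σ i) ∈ permMatching k τ := h ▸ longEdge_mem_permMatching σ i
  exact longEdge_right_injective i.is_lt (Fin.is_lt _) (Fin.is_lt _)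
    ((isPM_permMatching hk τ).eq_of_mem hi (longEdge_mem_permMatching τ i)
      (Sym2.mem_mk_left _ _) (Sym2.mem_mk_left _ _))

lemma IsPM.exists_longEdge_mem (hk : 1 ≤ k) {M : Finset (Sym2 (Vtx (3 * k)))}
    (hM : IsPM (3 * k) M) (hodd : ∀ e ∈ M, Odd (edgeOrder (3 * k) e))
    (hB : ∀ j < 2 * k, boundaryEdge k j ∈ M) (i : Fin k) :
    ∃ j : Fin k, longEdge k i j ∈ M := by
  obtain ⟨e, he, hx⟩ := hM.2.2 ((6 * i : ℕ) : Vtx (3 * k))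
  rcases hM.eq_boundaryEdge_or_forall_mem hk hB he with ⟨j, hj, rfl⟩ | h
  · rw [natCast_mem_boundaryEdge (by omega) hj] at hx
    omega
  · obtain ⟨y, rfl⟩ := hx
    obtain ⟨a, ha, rfl⟩ := h y (Sym2.mem_mk_right _ _)
    have h2 := hodd _ he
    rw [odd_edgeOrder_natCast (by omega) (by omega), Nat.odd_iff] at h2
    refine ⟨⟨a / 2, by omega⟩, ?_⟩
    rwa [longEdge, show 6 * (a / 2) + 3 = 3 * a by omega]

lemma IsPM.exists_eq_permMatching (hk : 1 ≤ k) {M : Finset (Sym2 (Vtx (3 * k)))}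
    (hM : IsPM (3 * k) M) (hodd : ∀ e ∈ M, Odd (edgeOrder (3 * k) e))
    (hB : ∀ j < 2 * k, boundaryEdge k j ∈ M) : ∃ σ, permMatching k σ = M := by
  choose s hs using hM.exists_longEdge_mem hk hodd hB
  have hinj : Function.Injective s := fun i i' h => by
    have hi' := hs i'
    rw [← h] at hi'
    exact Fin.ext (longEdge_left_injective i.is_lt i'.is_lt (s i).is_lt
      (hM.eq_of_mem (hs i) hi' (Sym2.mem_mk_right _ _) (Sym2.mem_mk_right _ _)))
  refine ⟨Equiv.ofBijective s (Finite.injective_iff_bijective.1 hinj),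
    hM.eq_of_subset (isPM_permMatching hk _) fun e he => ?_⟩
  rcases mem_permMatching.1 he with ⟨j, hj, rfl⟩ | ⟨i, rfl⟩
  · exact hB j hj
  · exact hs i

end SpecialMatchings

/-- Let `m = 3k`, `k ≥ 1`. Every perfect matching of `CGG(6k)` all of whose
edges have odd order and which contains all the boundary edges `{3j+1, 3j+2}`
for `0 ≤ j ≤ 2k - 1` is semi-simple, and the number of such perfect matchings
is exactly `k!`. -/
theorem special_matchings_semiSimple_and_count (k : ℕ) (hk : 1 ≤ k) :
    (∀ M : Finset (Sym2 (Vtx (3 * k))),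
      IsPM (3 * k) M → (∀ e ∈ M, Odd (edgeOrder (3 * k) e)) →
      (∀ j < 2 * k,
        s(((3 * j + 1 : ℕ) : Vtx (3 * k)), ((3 * j + 2 : ℕ) : Vtx (3 * k))) ∈ M) →
      IsSemiSimple (3 * k) M) ∧
    Nat.card {M : Finset (Sym2 (Vtx (3 * k))) //
        IsPM (3 * k) M ∧ (∀ e ∈ M, Odd (edgeOrder (3 * k) e)) ∧
        ∀ j < 2 * k,
          s(((3 * j + 1 : ℕ) : Vtx (3 * k)), ((3 * j + 2 : ℕ) : Vtx (3 * k))) ∈ M}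
      = Nat.factorial k := by
  refine ⟨fun M hM hodd hB => hM.isSemiSimple_of_boundaryEdge_mem hk hodd hB, ?_⟩
  let Φ : Equiv.Perm (Fin k) → {M : Finset (Sym2 (Vtx (3 * k))) //
      IsPM (3 * k) M ∧ (∀ e ∈ M, Odd (edgeOrder (3 * k) e)) ∧
      ∀ j < 2 * k, boundaryEdge k j ∈ M} := fun σ =>
    ⟨permMatching k σ, isPM_permMatching hk σ,
      fun _ he => odd_edgeOrder_of_mem_permMatching σ he,
      fun _ hj => boundaryEdge_mem_permMatching σ hj⟩
  have hΦ : Function.Bijective Φ := by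
    refine ⟨fun σ τ h => permMatching_injective hk (congrArg Subtype.val h), ?_⟩
    rintro ⟨M, hM, hodd, hB⟩
    obtain ⟨σ, hσ⟩ := hM.exists_eq_permMatching hk hodd hB
    exact ⟨σ, Subtype.ext hσ⟩
  have hcard := Nat.card_eq_of_bijective Φ hΦ
  rw [Nat.card_perm, Nat.card_fin] at hcard
  exact hcard.symm
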